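/- arXiv:2410.13417 — 2 statements merged into one kernel-verified Lean document; each statement's English description precedes it below -/
import Mathlib

section
/- Let Λ̃ be a countable group whose virtual center equals its center; write D = Z(Λ̃) and Λ = Λ̃/D. Assume that Λ is virtually isomorphic to an icc group that admits only countably many finite index subgroups. Then Λ admits a finite index subgroup that is icc. -/
/-- Two groups are virtually isomorphic if they admit finite index subgroups which become
isomorphic after quotienting by finite normal subgroups. -/
def VirtuallyIsomorphic (G H : Type*) [Group G] [Group H] : Prop :=
  ∃ (G₁ : Subgroup G) (H₁ : Subgroup H) (N : Subgroup G₁) (S : Subgroup H₁)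
    (_ : N.Normal) (_ : S.Normal),
    G₁.FiniteIndex ∧ H₁.FiniteIndex ∧ Finite N ∧ Finite S ∧
    Nonempty ((G₁ ⧸ N) ≃* (H₁ ⧸ S))

open scoped commutatorElement

/-- If the orbit of `g` under conjugation by a finite index subgroup is finite, then the conjugacy
class of `g` is finite. -/
theorem finite_isConj_of_finite_range_conj {G : Type*} [Group G] (K : Subgroup G) [K.FiniteIndex]
    (g : G) (h : (Set.range fun k : K => (k : G) * g * (k : G)⁻¹).Finite) :
    {x : G | IsConj g x}.Finite := by
  have hfin : Finite (G ⧸ K) := inferInstance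
  refine (Set.Finite.image2 (fun (q : G ⧸ K) (x : G) => q.out * x * q.out⁻¹)
    Set.finite_univ h).subset ?_
  intro x hx
  obtain ⟨a, rfl⟩ := isConj_iff.mp hx
  obtain ⟨k, hk⟩ := QuotientGroup.mk_out_eq_mul K a
  refine ⟨(a : G ⧸ K), Set.mem_univ _, _, ⟨k⁻¹, rfl⟩, ?_⟩
  simp only [hk, InvMemClass.coe_inv]
  group

/-- An infinite abelian group of prime exponent has uncountably many finite index subgroups. -/
theorem uncountable_finiteIndex_of_pow_prime_eq_one {V : Type*} [CommGroup V] [Infinite V]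
    (p : ℕ) [Fact p.Prime] (hp : ∀ v : V, v ^ p = 1) :
    Uncountable {K : Subgroup V // K.FiniteIndex} := by
  let _ : Module (ZMod p) (Additive V) := AddCommGroup.zmodModule (n := p) fun x => hp x.toMul
  let b := Module.Basis.ofVectorSpace (ZMod p) (Additive V)
  have hι : Infinite (Module.Basis.ofVectorSpaceIndex (ZMod p) (Additive V)) := by
    by_contra hfin
    rw [not_infinite_iff_finite] at hfin
    have := Module.Finite.of_basis b
    have : Finite (Additive V) := Module.finite_of_finite (ZMod p)
    exact not_finite (Additive V)
  classical
  let χ (T : Set (Module.Basis.ofVectorSpaceIndex (ZMod p) (Additive V))) :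
      V →* Multiplicative (ZMod p) :=
    AddMonoidHom.toMultiplicativeRight
      (b.constr ℕ fun i => if i ∈ T then (1 : ZMod p) else 0).toAddMonoidHom
  have hχ : ∀ T i, (b i).toMul ∈ (χ T).ker ↔ i ∉ T := by
    intro T i
    change Multiplicative.ofAdd ((b.constr ℕ fun i => if i ∈ T then (1 : ZMod p) else 0) (b i))
      = 1 ↔ _
    rw [Module.Basis.constr_basis, ofAdd_eq_one]
    split_ifs with h <;> simp [h]
  have hinj : Function.Injective
      fun T => (⟨(χ T).ker, inferInstance⟩ : {K : Subgroup V // K.FiniteIndex}) := by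
    intro T U hTU
    have hker : (χ T).ker = (χ U).ker := congrArg Subtype.val hTU
    ext i
    rw [← not_iff_not, ← hχ, ← hχ, hker]
  have : Uncountable (Set (Module.Basis.ofVectorSpaceIndex (ZMod p) (Additive V))) := by
    rw [← Cardinal.aleph0_lt_mk_iff, Cardinal.mk_set]
    exact (Cardinal.aleph0_le_mk _).trans_lt (Cardinal.cantor _)
  exact hinj.uncountable

/-- If `φ : L → G` has finite index image, and `G` has countably many finite index subgroups, then
a homomorphism from `L` to an abelian group of prime exponent that sends `φ.ker` to a finite set
has finite image. -/
theorem finite_range_of_countable_finiteIndex {L G V : Type*} [Group L] [Group G] [CommGroup V]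
    (hcnt : Countable {K : Subgroup G // K.FiniteIndex}) (φ : L →* G) [hφ : φ.range.FiniteIndex]
    (f : L →* V) (p : ℕ) [Fact p.Prime] (hp : ∀ x, f x ^ p = 1)
    (hker : Finite (φ.ker.map f)) : Finite f.range := by
  by_contra hinf
  rw [not_finite_iff_infinite] at hinf
  let M : Subgroup f.range := φ.ker.map f.rangeRestrict
  have hM : Finite M := by
    have hmap : M.map f.range.subtype = φ.ker.map f := by
      rw [Subgroup.map_map, MonoidHom.subtype_comp_rangeRestrict]
    rw [← hmap] at hker
    exact .of_equiv _ (M.equivMapOfInjective _ f.range.subtype_injective).symm.toEquiv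
  have hW : Infinite (f.range ⧸ M) := by
    by_contra hfin
    rw [not_infinite_iff_finite] at hfin
    have : Finite f.range := .of_equiv _ (Subgroup.groupEquivQuotientProdSubgroup (s := M)).symm
    exact not_finite f.range
  have huncnt := uncountable_finiteIndex_of_pow_prime_eq_one (V := f.range ⧸ M) p (by
    intro v
    obtain ⟨⟨_, x, rfl⟩, rfl⟩ := QuotientGroup.mk_surjective v
    rw [← QuotientGroup.mk_pow]
    have : (⟨f x, x, rfl⟩ : f.range) ^ p = 1 := Subtype.ext (hp x)
    rw [this, QuotientGroup.mk_one])
  let F : L →* f.range ⧸ M := (QuotientGroup.mk' M).comp f.rangeRestrict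
  have hF : Function.Surjective F :=
    (QuotientGroup.mk'_surjective M).comp f.rangeRestrict_surjective
  have hle (K : Subgroup (f.range ⧸ M)) : φ.ker ≤ K.comap F := by
    intro x hx
    have : F x = 1 := (QuotientGroup.eq_one_iff _).mpr ⟨x, hx, rfl⟩
    rw [Subgroup.mem_comap, this]
    exact K.one_mem
  have hfi (K : Subgroup (f.range ⧸ M)) (hK : K.FiniteIndex) :
      ((K.comap F).map φ).FiniteIndex := by
    refine ⟨?_⟩
    rw [Subgroup.index_map, sup_eq_left.mpr (hle K), Subgroup.index_comap_of_surjective K hF]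
    exact mul_ne_zero hK.index_ne_zero hφ.index_ne_zero
  have hinj : Function.Injective fun K : {K : Subgroup (f.range ⧸ M) // K.FiniteIndex} =>
      (⟨(K.1.comap F).map φ, hfi K.1 K.2⟩ : {K : Subgroup G // K.FiniteIndex}) := by
    intro K K' h
    have h' : (K.1.comap F).map φ = (K'.1.comap F).map φ := congrArg Subtype.val h
    apply Subtype.ext
    apply Subgroup.comap_injective hF
    rw [← Subgroup.comap_map_eq_self (hle K.1), h', Subgroup.comap_map_eq_self (hle K'.1)]
  have := hinj.uncountable
  exact not_countable hcnt

/-- If `G` is icc and virtually isomorphic to `H`, then some finite index subgroup of `H` maps to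
`G` with finite kernel and finite index image. -/
theorem VirtuallyIsomorphic.exists_monoidHom {G H : Type*} [Group G] [Group H]
    (hicc : ∀ g : G, g ≠ 1 → {h : G | IsConj g h}.Infinite) (hvi : VirtuallyIsomorphic G H) :
    ∃ (K : Subgroup H) (φ : K →* G),
      K.FiniteIndex ∧ φ.range.FiniteIndex ∧ Finite φ.ker := by
  obtain ⟨G₁, H₁, N, S, hN, hS, hG₁, hH₁, hNfin, hSfin, ⟨e⟩⟩ := hvi
  have hbot : N = ⊥ := by
    rw [eq_bot_iff]
    intro n hn
    by_contra hne
    refine hicc (n : G) (fun h => hne (Subtype.ext h)) ?_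
    apply finite_isConj_of_finite_range_conj G₁
    refine ((Set.toFinite (N : Set G₁)).image ((↑) : G₁ → G)).subset ?_
    rintro _ ⟨k, rfl⟩
    exact ⟨k * n * k⁻¹, hN.conj_mem n hn k, rfl⟩
  subst hbot
  let ψ : H₁ ⧸ S ≃* G₁ := e.symm.trans QuotientGroup.quotientBot
  let φ : H₁ →* G := G₁.subtype.comp (ψ.toMonoidHom.comp (QuotientGroup.mk' S))
  have hrange : φ.range = G₁ := by
    rw [MonoidHom.range_comp, MonoidHom.range_eq_top.mpr
      (ψ.surjective.comp (QuotientGroup.mk'_surjective S)), ← MonoidHom.range_eq_map,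
      Subgroup.range_subtype]
  have hker : φ.ker = S := by
    ext x
    simp [φ, MonoidHom.mem_ker]
  exact ⟨H₁, φ, hH₁, hrange ▸ hG₁, hker ▸ hSfin⟩

/-- If `s` commutes with every element of `K` modulo the center, then `k ↦ ⁅k, s⁆` is a
homomorphism from `K` to the center. -/
def commutatorHom {Γ : Type*} [Group Γ] (K : Subgroup Γ) (s : Γ)
    (h : ∀ k ∈ K, ⁅k, s⁆ ∈ Subgroup.center Γ) : K →* Subgroup.center Γ where
  toFun k := ⟨⁅(k : Γ), s⁆, h k k.2⟩
  map_one' := by simp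
  map_mul' a b := by
    apply Subtype.ext
    have hb := Subgroup.mem_center_iff.mp (h b b.2) (a : Γ)
    calc ⁅(a : Γ) * b, s⁆ = a * ⁅(b : Γ), s⁆ * s * (a : Γ)⁻¹ * s⁻¹ := by
          simp only [commutatorElement_def]; group
      _ = ⁅(b : Γ), s⁆ * ⁅(a : Γ), s⁆ := by
          rw [hb]; simp only [commutatorElement_def]; group
      _ = ⁅(a : Γ), s⁆ * ⁅(b : Γ), s⁆ :=
          (Subgroup.mem_center_iff.mp (h b b.2) _).symm

theorem commutatorElement_pow_eq_one {Γ : Type*} [Group Γ] {k s : Γ} {n : ℕ}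
    (hc : ⁅k, s⁆ ∈ Subgroup.center Γ) (hs : s ^ n ∈ Subgroup.center Γ) : ⁅k, s⁆ ^ n = 1 := by
  have hcomm : Commute ⁅k, s⁆ s := (Subgroup.mem_center_iff.mp hc s).symm
  have hconj : ⁅k, s⁆ * s = k * s * k⁻¹ := by simp [commutatorElement_def]
  have hpow : ⁅k, s⁆ ^ n * s ^ n = s ^ n := by
    rw [← hcomm.mul_pow, hconj, conj_pow, Subgroup.mem_center_iff.mp hs k, mul_inv_cancel_right]
  exact mul_eq_right.mp hpow

/-- Let `Λt` be a countable group whose virtual center (the set of elements with finite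
conjugacy class) equals its center, and let `Λ = Λt / Z(Λt)`. If `Λ` is virtually isomorphic
to an icc group admitting only countably many finite index subgroups, then `Λ` admits a
finite index subgroup that is icc. -/
theorem exists_finiteIndex_icc_subgroup
    (Λt : Type*) [Group Λt] [Countable Λt]
    (hfc : ∀ g : Λt, {h : Λt | IsConj g h}.Finite ↔ g ∈ Subgroup.center Λt)
    (G : Type*) [Group G]
    (hicc : ∀ g : G, g ≠ 1 → {h : G | IsConj g h}.Infinite)
    (hcnt : Countable {H : Subgroup G // H.FiniteIndex})
    (hvi : VirtuallyIsomorphic G (Λt ⧸ Subgroup.center Λt)) :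
    ∃ H : Subgroup (Λt ⧸ Subgroup.center Λt), H.FiniteIndex ∧
      ∀ g : H, g ≠ 1 → {h : H | IsConj g h}.Infinite := by
  obtain ⟨H₁, φ, hH₁, hφ, hkerfin⟩ := hvi.exists_monoidHom hicc
  let π := QuotientGroup.mk' (Subgroup.center Λt)
  let C : Subgroup H₁ := (MulAut.conjNormal (H := φ.ker)).ker
  have hC : C.FiniteIndex := by
    have : Finite (MulAut φ.ker) := .of_injective (fun e => (e : φ.ker → φ.ker))
      DFunLike.coe_injective
    exact Subgroup.finiteIndex_ker _
  have hCcomm : ∀ c ∈ C, ∀ s ∈ φ.ker, c * s * c⁻¹ = s := by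
    intro c hc s hs
    have := congrArg (fun e : MulAut φ.ker => ((e ⟨s, hs⟩ : φ.ker) : H₁)) (MonoidHom.mem_ker.mp hc)
    simpa using this
  have hmapC : (C.map φ).FiniteIndex := by
    refine ⟨?_⟩
    rw [Subgroup.index_map]
    have := Subgroup.finiteIndex_of_le (H := C) (K := C ⊔ φ.ker) le_sup_left
    exact mul_ne_zero this.index_ne_zero hφ.index_ne_zero
  let H₂ := C.map H₁.subtype
  have hH₂ : H₂.FiniteIndex := by
    refine ⟨?_⟩
    rw [Subgroup.index_map_subtype]
    exact mul_ne_zero hC.index_ne_zero hH₁.index_ne_zero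
  have hle : H₂ ≤ H₁ := Subgroup.map_subtype_le C
  have hmemC : ∀ x : H₂, Subgroup.inclusion hle x ∈ C := by
    rintro ⟨_, c, hc, rfl⟩
    exact hc
  refine ⟨H₂, hH₂, fun g hg hgfin => ?_⟩
  let g₁ : H₁ := Subgroup.inclusion hle g
  have hg₁ : g₁ ∈ φ.ker := by
    by_contra hne
    refine hicc (φ g₁) hne ?_
    apply finite_isConj_of_finite_range_conj (C.map φ)
    refine (hgfin.image fun x => φ (Subgroup.inclusion hle x)).subset ?_
    rintro _ ⟨⟨_, c, hc, rfl⟩, rfl⟩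
    let c₂ : H₂ := ⟨c, c, hc, rfl⟩
    refine ⟨c₂ * g * c₂⁻¹, isConj_iff.mpr ⟨c₂, rfl⟩, ?_⟩
    simp only [map_mul, map_inv]
    rfl
  have hg₁ne : g₁ ≠ 1 := fun h => hg (Subgroup.inclusion_injective hle (by simpa using h))
  obtain ⟨s, p, hs, hsne, hp, hsp⟩ :
      ∃ (s : H₁) (p : ℕ), s ∈ φ.ker ∧ s ≠ 1 ∧ p.Prime ∧ s ^ p = 1 := by
    have hpos : 0 < orderOf g₁ := by
      have : IsOfFinOrder (⟨g₁, hg₁⟩ : φ.ker) := isOfFinOrder_of_finite _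
      rw [← Subgroup.orderOf_mk g₁ hg₁]
      exact this.orderOf_pos
    have hne1 : orderOf g₁ ≠ 1 := fun h => hg₁ne (orderOf_eq_one_iff.mp h)
    obtain ⟨p, hp, m, hm⟩ := Nat.exists_prime_and_dvd hne1
    refine ⟨g₁ ^ m, p, pow_mem hg₁ m, fun h => ?_, hp, ?_⟩
    · have hmpos : 0 < m := by
        rcases Nat.eq_zero_or_pos m with rfl | h
        · omega
        · exact h
      have := Nat.le_of_dvd hmpos (orderOf_dvd_of_pow_eq_one h)
      nlinarith [hp.two_le]
    · rw [← pow_mul, mul_comm, ← hm, pow_orderOf_eq_one]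
  have : Fact p.Prime := ⟨hp⟩
  obtain ⟨st, hst⟩ := QuotientGroup.mk'_surjective (Subgroup.center Λt) (s : Λt ⧸ _)
  have hmem_center : ∀ x : Λt, π x = 1 ↔ x ∈ Subgroup.center Λt := fun x =>
    QuotientGroup.eq_one_iff x
  let L := H₂.comap π
  have hL : L.FiniteIndex := by
    refine ⟨?_⟩
    rw [Subgroup.index_comap_of_surjective H₂ (QuotientGroup.mk'_surjective _)]
    exact hH₂.index_ne_zero
  let ι : L →* H₁ := (Subgroup.inclusion hle).comp (π.subgroupComap H₂)
  have hιC : ∀ x, ι x ∈ C := fun x => hmemC _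
  have hι : ∀ x : L, ((ι x : H₁) : Λt ⧸ Subgroup.center Λt) = π x := fun x => rfl
  have hcomm : ∀ k ∈ L, ⁅k, st⁆ ∈ Subgroup.center Λt := by
    intro k hk
    have h := congrArg Subtype.val (hCcomm (ι ⟨k, hk⟩) (hιC _) s hs)
    rw [← hmem_center, map_commutatorElement, commutatorElement_def, show π st = s from hst]
    change π k * s * (π k)⁻¹ = s at h
    rw [h, mul_inv_cancel]
  have hstp : st ^ p ∈ Subgroup.center Λt := by
    rw [← hmem_center, map_pow, show π st = s from hst, ← Subgroup.coe_pow, hsp, Subgroup.coe_one]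
  let f := commutatorHom L st hcomm
  have hιrange : ι.range = C := by
    ext c
    constructor
    · rintro ⟨x, rfl⟩
      exact hιC x
    · intro hc
      obtain ⟨x, hx⟩ := QuotientGroup.mk'_surjective (Subgroup.center Λt) (c : Λt ⧸ _)
      exact ⟨⟨x, c, hc, hx.symm⟩, Subtype.ext hx⟩
  have hrange : (φ.comp ι).range.FiniteIndex := by
    rwa [MonoidHom.range_comp, hιrange]
  have hιf : ∀ x y : L, ι x = ι y → f x = f y := by
    intro x y hxy
    have hπ : π x = π y := congrArg Subtype.val hxy
    rw [← div_eq_one, ← map_div]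
    have hz : (x : Λt) / y ∈ Subgroup.center Λt := by
      rw [← hmem_center, map_div, hπ, div_self']
    apply Subtype.ext
    change ⁅(x : Λt) / y, st⁆ = 1
    exact commutatorElement_eq_one_iff_mul_comm.mpr (Subgroup.mem_center_iff.mp hz st).symm
  have hfker : Finite ((φ.comp ι).ker.map f) := by
    have hιker : (ι '' ((φ.comp ι).ker : Set L)).Finite :=
      (Set.toFinite (φ.ker : Set H₁)).subset (by rintro _ ⟨x, hx, rfl⟩; exact hx)
    have hfac : ∃ u : H₁ → Subgroup.center Λt, ∀ x, u (ι x) = f x :=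
      ⟨Function.extend ι f 1, fun x => Function.FactorsThrough.extend_apply
        (fun a b h => hιf a b h) _ x⟩
    obtain ⟨u, hu⟩ := hfac
    refine ((hιker.image u).subset ?_).to_subtype
    rintro _ ⟨x, hx, rfl⟩
    exact ⟨ι x, ⟨x, hx, rfl⟩, hu x⟩
  open scoped IsMulCommutative in
  have hfin : Finite f.range := finite_range_of_countable_finiteIndex hcnt (φ.comp ι) f p
    (fun x => Subtype.ext (commutatorElement_pow_eq_one (hcomm x x.2) hstp)) hfker
  have hst_center : st ∈ Subgroup.center Λt := by
    rw [← hfc]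
    apply finite_isConj_of_finite_range_conj L
    refine ((Set.toFinite (f.range : Set (Subgroup.center Λt))).image
      fun d : Subgroup.center Λt => (d : Λt) * st).subset ?_
    rintro _ ⟨k, rfl⟩
    refine ⟨f k, ⟨k, rfl⟩, ?_⟩
    change ⁅(k : Λt), st⁆ * st = _
    simp [commutatorElement_def]
  exact hsne (Subtype.ext (hst.symm.trans ((hmem_center st).mpr hst_center)))
end

section
/- Let 𝒫 be a nonempty set of prime numbers and let C = ℤ[𝒫⁻¹] be the subring of ℚ generated by {1/p : p ∈ 𝒫}. (i) Every automorphism φ of the additive group C × C is given by multiplication by a 2×2 matrix A with entries in C whose determinant is a unit of the ring C, i.e., φ(a,b) = (A₁₁a + A₁₂b, A₂₁a + A₂₂b). (ii) Such an automorphism φ can be lifted along the abelianization homomorphism ζ : C ∗ C → C × C of the free product of two copies of the additive group C to an automorphism δ of C ∗ C (meaning ζ ∘ δ = φ ∘ ζ) if and only if there exist units c, d of the ring C such that either φ(a,b) = (c·a, d·b) for all a,b ∈ C, or φ(a,b) = (d·b, c·a) for all a,b ∈ C. -/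
/-- The subring `ℤ[𝒫⁻¹]` of `ℚ` generated by the inverses of the primes in `𝒫`. -/
noncomputable def PRing (P : Set ℕ) : Subring ℚ :=
  Subring.closure {x : ℚ | ∃ p ∈ P, x = (p : ℚ)⁻¹}

/-- The abelianization homomorphism `ζ : C ∗ C → C × C` of the free product of two copies of
the additive group `C = ℤ[𝒫⁻¹]`, identified via the two canonical embeddings. -/
noncomputable def zetaHom (P : Set ℕ) :
    Monoid.Coprod (Multiplicative ↥(PRing P)) (Multiplicative ↥(PRing P)) →*
      Multiplicative (↥(PRing P) × ↥(PRing P)) :=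
  Monoid.Coprod.lift
    (AddMonoidHom.toMultiplicative (AddMonoidHom.inl ↥(PRing P) ↥(PRing P)))
    (AddMonoidHom.toMultiplicative (AddMonoidHom.inr ↥(PRing P) ↥(PRing P)))

open Polynomial Multiplicative

/-- The representation of `R ∗ R` by products of the matrices `!![1, x; 0, 1]` and
`!![1, 0; y * X, 1]` over `R[X]`. -/
noncomputable def unipotentRep (R : Type*) [CommRing R] :
    Monoid.Coprod (Multiplicative R) (Multiplicative R) →* Matrix (Fin 2) (Fin 2) R[X] :=
  Monoid.Coprod.lift
    { toFun := fun x => !![1, C x.toAdd; 0, 1]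
      map_one' := by simp [Matrix.one_fin_two]
      map_mul' := fun x y => by simp [add_comm] }
    { toFun := fun y => !![1, 0; C y.toAdd * X, 1]
      map_one' := by simp [Matrix.one_fin_two]
      map_mul' := fun x y => by simp [add_mul] }

section UnipotentRep

variable {R : Type*} [CommRing R]

theorem unipotentRep_inl (x : Multiplicative R) :
    unipotentRep R (Monoid.Coprod.inl x) = !![1, C x.toAdd; 0, 1] :=
  Monoid.Coprod.lift_apply_inl _ _ _

theorem unipotentRep_inr (y : Multiplicative R) :
    unipotentRep R (Monoid.Coprod.inr y) = !![1, 0; C y.toAdd * X, 1] :=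
  Monoid.Coprod.lift_apply_inr _ _ _

theorem det_unipotentRep (w : Monoid.Coprod (Multiplicative R) (Multiplicative R)) :
    (unipotentRep R w).det = 1 := by
  induction w using Monoid.Coprod.induction_on' with
  | one => simp
  | inl_mul x w ih => rw [map_mul, Matrix.det_mul, ih, unipotentRep_inl]; simp
  | inr_mul y w ih => rw [map_mul, Matrix.det_mul, ih, unipotentRep_inr]; simp

end UnipotentRep

theorem trace_pow_add_two {S : Type*} [CommRing S] (M : Matrix (Fin 2) (Fin 2) S)
    (hM : M.det = 1) (k : ℕ) :
    (M ^ (k + 2)).trace = M.trace * (M ^ (k + 1)).trace - (M ^ k).trace := by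
  have hsq : M * M = M.trace • M - 1 := by
    rw [Matrix.det_fin_two] at hM
    ext i j
    fin_cases i <;> fin_cases j <;>
      simp [Matrix.mul_apply, Fin.sum_univ_two, Matrix.trace_fin_two] <;>
      first | ring1 | linear_combination -hM
  rw [pow_add, pow_two, hsq, mul_sub, mul_one, Matrix.mul_smul, ← pow_succ, Matrix.trace_sub,
    Matrix.trace_smul, smul_eq_mul]

theorem natDegree_trace_pow {R : Type*} [CommRing R] [IsDomain R]
    (M : Matrix (Fin 2) (Fin 2) R[X]) (hM : M.det = 1) (hd : 0 < M.trace.natDegree) (k : ℕ) :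
    (M ^ k).trace.natDegree = k * M.trace.natDegree := by
  induction k using Nat.twoStepInduction with
  | zero =>
    rw [pow_zero, zero_mul, Matrix.trace_one, natDegree_natCast]
  | one => simp
  | more k h0 h1 =>
    have hne : (M ^ (k + 1)).trace ≠ 0 := by
      intro h
      rw [h, natDegree_zero] at h1
      exact (Nat.mul_pos k.succ_pos hd).ne h1
    have hne' : M.trace ≠ 0 := fun h => by simp [h] at hd
    have hmul : (M.trace * (M ^ (k + 1)).trace).natDegree = (k + 2) * M.trace.natDegree := by
      rw [natDegree_mul hne' hne, h1]
      ring
    rw [trace_pow_add_two M hM, natDegree_sub_eq_left_of_natDegree_lt, hmul]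
    rw [hmul, h0]
    exact Nat.mul_lt_mul_of_pos_right (by omega) hd

section Zeta

variable {P : Set ℕ}

theorem zetaHom_inl (x : Multiplicative (PRing P)) :
    zetaHom P (Monoid.Coprod.inl x) = ofAdd (x.toAdd, 0) :=
  Monoid.Coprod.lift_apply_inl _ _ _

theorem zetaHom_inr (y : Multiplicative (PRing P)) :
    zetaHom P (Monoid.Coprod.inr y) = ofAdd (0, y.toAdd) :=
  Monoid.Coprod.lift_apply_inr _ _ _

theorem unipotentRep_coeff
    (w : Monoid.Coprod (Multiplicative (PRing P)) (Multiplicative (PRing P))) :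
    (unipotentRep _ w 0 0).coeff 0 = 1 ∧ (unipotentRep _ w 1 1).coeff 0 = 1 ∧
    (unipotentRep _ w 1 0).coeff 0 = 0 ∧
    (unipotentRep _ w 0 1).coeff 0 = (zetaHom P w).toAdd.1 ∧
    (unipotentRep _ w 1 0).coeff 1 = (zetaHom P w).toAdd.2 ∧
    (unipotentRep _ w).trace.coeff 1 = (zetaHom P w).toAdd.1 * (zetaHom P w).toAdd.2 := by
  induction w using Monoid.Coprod.induction_on' with
  | one => simp [coeff_one]
  | inl_mul x w ih =>
    obtain ⟨h1, h2, h3, h4, h5, h6⟩ := ih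
    simp only [Matrix.trace_fin_two, coeff_add] at h6
    simp only [map_mul, unipotentRep_inl, Matrix.trace_fin_two, Matrix.mul_apply,
      Fin.sum_univ_two]
    simp [zetaHom_inl, h1, h2, h3, h4, h5]
    constructor
    · ring
    · linear_combination h6
  | inr_mul y w ih =>
    obtain ⟨h1, h2, h3, h4, h5, h6⟩ := ih
    simp only [Matrix.trace_fin_two, coeff_add] at h6
    simp only [map_mul, unipotentRep_inr, Matrix.trace_fin_two, Matrix.mul_apply,
      Fin.sum_univ_two]
    simp [zetaHom_inr, mul_assoc, coeff_X_mul, h1, h2, h3, h4, h5]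
    linear_combination h6

/-- The image under `ζ` of an element with roots of unbounded order lies in one of the factors. -/
theorem zetaHom_fst_mul_snd_eq_zero
    (g : Monoid.Coprod (Multiplicative (PRing P)) (Multiplicative (PRing P)))
    (hg : ∀ n : ℕ, ∃ k ≥ n, ∃ r, r ^ (k + 1) = g) :
    (zetaHom P g).toAdd.1 * (zetaHom P g).toAdd.2 = 0 := by
  by_contra hne
  obtain ⟨k, hk, r, rfl⟩ := hg (unipotentRep _ g).trace.natDegree
  have hr : (zetaHom P r).toAdd.1 * (zetaHom P r).toAdd.2 ≠ 0 := by
    intro h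
    apply hne
    simp only [map_pow, toAdd_pow, Prod.smul_fst, Prod.smul_snd, smul_mul_smul_comm, h, smul_zero]
  rw [← (unipotentRep_coeff r).2.2.2.2.2] at hr
  have hd : 0 < (unipotentRep _ r).trace.natDegree := le_natDegree_of_ne_zero hr
  rw [map_pow, natDegree_trace_pow _ (det_unipotentRep r) hd] at hk
  nlinarith

theorem addMonoidHom_apply_eq_mul (f : PRing P →+ PRing P) (x : PRing P) : f x = f 1 * x := by
  have hx : x.1.den • x = x.1.num • (1 : PRing P) := by
    ext
    simp
  have hf : x.1.den • f x = x.1.num • f 1 := by rw [← map_nsmul, hx, map_zsmul]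
  have hden : (x.1.den : PRing P) ≠ 0 := by exact_mod_cast x.1.den_nz
  apply mul_left_cancel₀ hden
  simp only [nsmul_eq_mul, zsmul_eq_mul, mul_one] at hx hf
  rw [hf, mul_left_comm, hx, mul_comm]

theorem addMonoidHom_prod_apply (f : PRing P × PRing P →+ PRing P × PRing P) (x y : PRing P) :
    f (x, y) = ((f (1, 0)).1 * x + (f (0, 1)).1 * y, (f (1, 0)).2 * x + (f (0, 1)).2 * y) := by
  have h : f (x, y) = f (x, 0) + f (0, y) := by rw [← map_add]; simp
  have h1 := addMonoidHom_apply_eq_mul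
    ((AddMonoidHom.fst _ _).comp (f.comp (AddMonoidHom.inl _ _))) x
  have h2 := addMonoidHom_apply_eq_mul
    ((AddMonoidHom.snd _ _).comp (f.comp (AddMonoidHom.inl _ _))) x
  have h3 := addMonoidHom_apply_eq_mul
    ((AddMonoidHom.fst _ _).comp (f.comp (AddMonoidHom.inr _ _))) y
  have h4 := addMonoidHom_apply_eq_mul
    ((AddMonoidHom.snd _ _).comp (f.comp (AddMonoidHom.inr _ _))) y
  simp only [AddMonoidHom.comp_apply, AddMonoidHom.inl_apply, AddMonoidHom.inr_apply,
    AddMonoidHom.coe_fst, AddMonoidHom.coe_snd] at h1 h2 h3 h4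
  rw [h]
  ext1
  · rw [Prod.fst_add, h1, h3]
  · rw [Prod.snd_add, h2, h4]

theorem isUnit_det_addEquiv (φ : (PRing P × PRing P) ≃+ (PRing P × PRing P)) :
    IsUnit ((φ (1, 0)).1 * (φ (0, 1)).2 - (φ (0, 1)).1 * (φ (1, 0)).2) := by
  have hφ := addMonoidHom_prod_apply φ.toAddMonoidHom
  simp only [AddEquiv.toAddMonoidHom_eq_coe, AddMonoidHom.coe_coe] at hφ
  have h1 := φ.apply_symm_apply (1, 0)
  have h2 := φ.apply_symm_apply (0, 1)
  rw [← Prod.mk.eta (p := φ.symm (1, 0)), hφ, Prod.ext_iff] at h1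
  rw [← Prod.mk.eta (p := φ.symm (0, 1)), hφ, Prod.ext_iff] at h2
  obtain ⟨h11, h12⟩ := h1
  obtain ⟨h21, h22⟩ := h2
  refine IsUnit.of_mul_eq_one ((φ.symm (1, 0)).1 * (φ.symm (0, 1)).2 -
    (φ.symm (0, 1)).1 * (φ.symm (1, 0)).2) ?_
  dsimp only at h11 h12 h21 h22
  generalize (φ (1, 0)).1 = a at *
  generalize (φ (0, 1)).1 = b at *
  generalize (φ (1, 0)).2 = c at *
  generalize (φ (0, 1)).2 = d at *
  linear_combination h11 * (c * (φ.symm (0, 1)).1 + d * (φ.symm (0, 1)).2) + h22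
    - h12 * (a * (φ.symm (0, 1)).1 + b * (φ.symm (0, 1)).2)

/-- Images of elements of `C` under a homomorphism to `C ∗ C` project into one of the factors. -/
theorem zetaHom_comp_fst_mul_snd_eq_zero (hP : ∀ p ∈ P, p.Prime) (hne : P.Nonempty)
    (f : Multiplicative (PRing P) →*
      Monoid.Coprod (Multiplicative (PRing P)) (Multiplicative (PRing P)))
    (x : Multiplicative (PRing P)) :
    (zetaHom P (f x)).toAdd.1 * (zetaHom P (f x)).toAdd.2 = 0 := by
  obtain ⟨p, hp⟩ := hne
  refine zetaHom_fst_mul_snd_eq_zero _ fun n => ?_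
  let q : PRing P := ⟨(p : ℚ)⁻¹, Subring.subset_closure ⟨p, hp, rfl⟩⟩
  have hq : (p : PRing P) * q = 1 := by
    ext
    have : (p : ℚ) ≠ 0 := by exact_mod_cast (hP p hp).ne_zero
    simp [q, this]
  have hpn : n < p ^ n := Nat.lt_pow_self (hP p hp).one_lt
  refine ⟨p ^ n - 1, by omega, f (ofAdd (q ^ n * x.toAdd)), ?_⟩
  rw [Nat.sub_add_cancel (by omega), ← map_pow, ← ofAdd_nsmul, nsmul_eq_mul, ← mul_assoc,
    Nat.cast_pow, ← mul_pow, hq, one_pow, one_mul, ofAdd_toAdd]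

/-- Multiplication by a unit of `C`, as an automorphism of the additive group of `C`. -/
noncomputable def unitMulEquiv (u : (PRing P)ˣ) :
    Multiplicative (PRing P) ≃* Multiplicative (PRing P) :=
  AddEquiv.toMultiplicative (DistribMulAction.toAddEquiv (PRing P) u)

theorem toAdd_unitMulEquiv (u : (PRing P)ˣ) (x : Multiplicative (PRing P)) :
    (unitMulEquiv u x).toAdd = u * x.toAdd := rfl

theorem zetaHom_lift_of_comp_inl_inr
    (δ : Monoid.Coprod (Multiplicative (PRing P)) (Multiplicative (PRing P)) →*
      Monoid.Coprod (Multiplicative (PRing P)) (Multiplicative (PRing P)))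
    (φ : (PRing P × PRing P) →+ (PRing P × PRing P))
    (hl : ∀ x, (zetaHom P (δ (Monoid.Coprod.inl x))).toAdd = φ (x.toAdd, 0))
    (hr : ∀ y, (zetaHom P (δ (Monoid.Coprod.inr y))).toAdd = φ (0, y.toAdd))
    (w : Monoid.Coprod (Multiplicative (PRing P)) (Multiplicative (PRing P))) :
    zetaHom P (δ w) = ofAdd (φ (zetaHom P w).toAdd) := by
  have h : (zetaHom P).comp δ = (AddMonoidHom.toMultiplicative φ).comp (zetaHom P) := by
    refine Monoid.Coprod.hom_ext (MonoidHom.ext fun x => ?_) (MonoidHom.ext fun y => ?_)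
    · simpa [zetaHom_inl] using congrArg ofAdd (hl x)
    · simpa [zetaHom_inr] using congrArg ofAdd (hr y)
  exact DFunLike.congr_fun h w

end Zeta

/-- Let `𝒫` be a nonempty set of primes and `C = ℤ[𝒫⁻¹]`.
(i) Every automorphism of the additive group `C × C` is given by a `2×2` matrix over `C`
whose determinant is a unit of the ring `C`.
(ii) Such an automorphism lifts along the abelianization homomorphism `ζ : C ∗ C → C × C`
to an automorphism of the free product `C ∗ C` iff it is of the form `(a,b) ↦ (c·a, d·b)`
or `(a,b) ↦ (d·b, c·a)` for units `c`, `d` of the ring `C`. -/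
theorem aut_prod_PRing_and_lifting (P : Set ℕ) (hP : ∀ p ∈ P, p.Prime)
    (hne : P.Nonempty) :
    (∀ φ : (↥(PRing P) × ↥(PRing P)) ≃+ (↥(PRing P) × ↥(PRing P)),
      ∃ a b c d : ↥(PRing P), IsUnit (a * d - b * c) ∧
        ∀ x y : ↥(PRing P), φ (x, y) = (a * x + b * y, c * x + d * y))
    ∧
    (∀ φ : (↥(PRing P) × ↥(PRing P)) ≃+ (↥(PRing P) × ↥(PRing P)),
      ((∃ δ : Monoid.Coprod (Multiplicative ↥(PRing P)) (Multiplicative ↥(PRing P)) ≃*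
            Monoid.Coprod (Multiplicative ↥(PRing P)) (Multiplicative ↥(PRing P)),
          ∀ w, zetaHom P (δ w) = Multiplicative.ofAdd (φ (Multiplicative.toAdd (zetaHom P w))))
        ↔
        (∃ c d : ↥(PRing P), IsUnit c ∧ IsUnit d ∧
          ((∀ x y : ↥(PRing P), φ (x, y) = (c * x, d * y)) ∨
           (∀ x y : ↥(PRing P), φ (x, y) = (d * y, c * x)))))) := by
  have key : ∀ φ : (PRing P × PRing P) ≃+ (PRing P × PRing P), ∀ x y : PRing P,
      φ (x, y) = ((φ (1, 0)).1 * x + (φ (0, 1)).1 * y, (φ (1, 0)).2 * x + (φ (0, 1)).2 * y) :=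
    fun φ => addMonoidHom_prod_apply φ.toAddMonoidHom
  refine ⟨fun φ => ⟨_, _, _, _, isUnit_det_addEquiv φ, key φ⟩, fun φ => ⟨?_, ?_⟩⟩
  · rintro ⟨δ, hδ⟩
    have h1 := zetaHom_comp_fst_mul_snd_eq_zero hP hne
      (δ.toMonoidHom.comp Monoid.Coprod.inl) (ofAdd 1)
    have h2 := zetaHom_comp_fst_mul_snd_eq_zero hP hne
      (δ.toMonoidHom.comp Monoid.Coprod.inr) (ofAdd 1)
    simp only [MulEquiv.toMonoidHom_eq_coe, MonoidHom.comp_apply, MonoidHom.coe_coe, hδ,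
      zetaHom_inl, zetaHom_inr, toAdd_ofAdd] at h1 h2
    have hφ := key φ
    have hu := isUnit_det_addEquiv φ
    generalize (φ (1, 0)).1 = a at *
    generalize (φ (0, 1)).1 = b at *
    generalize (φ (1, 0)).2 = c at *
    generalize (φ (0, 1)).2 = d at *
    rcases mul_eq_zero.mp h1 with rfl | rfl
    · rw [zero_mul, zero_sub, IsUnit.neg_iff, IsUnit.mul_iff] at hu
      obtain rfl := (mul_eq_zero.mp h2).resolve_left hu.1.ne_zero
      exact ⟨c, b, hu.2, hu.1, Or.inr fun x y => by simp [hφ]⟩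
    · rw [mul_zero, sub_zero, IsUnit.mul_iff] at hu
      obtain rfl := (mul_eq_zero.mp h2).resolve_right hu.2.ne_zero
      exact ⟨a, d, hu.1, hu.2, Or.inl fun x y => by simp [hφ]⟩
  · rintro ⟨_, _, ⟨c, rfl⟩, ⟨d, rfl⟩, hφ | hφ⟩
    · refine ⟨MulEquiv.coprodCongr (unitMulEquiv c) (unitMulEquiv d),
        zetaHom_lift_of_comp_inl_inr (MulEquiv.toMonoidHom _) φ.toAddMonoidHom
          (fun x => ?_) (fun y => ?_)⟩
      · simp [MulEquiv.coprodCongr, zetaHom_inl, hφ, toAdd_unitMulEquiv]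
      · simp [MulEquiv.coprodCongr, zetaHom_inr, hφ, toAdd_unitMulEquiv]
    · refine ⟨(MulEquiv.coprodCongr (unitMulEquiv c) (unitMulEquiv d)).trans
        (MulEquiv.coprodComm _ _),
        zetaHom_lift_of_comp_inl_inr (MulEquiv.toMonoidHom _) φ.toAddMonoidHom
          (fun x => ?_) (fun y => ?_)⟩
      · simp [MulEquiv.coprodCongr, zetaHom_inr, hφ, toAdd_unitMulEquiv]
      · simp [MulEquiv.coprodCongr, zetaHom_inl, hφ, toAdd_unitMulEquiv]
end
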